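/- Let p be a polynomial with complex coefficients which has nonzero constant term and satisfies ‖p(z)‖ = 1 for all z ∈ ℂ with ‖z‖ = 1. Then p is a constant polynomial. -/

import Mathlib

/-- A complex polynomial with nonzero constant term whose values on the
unit circle are all of norm one is constant. -/
theorem constant_of_unimodular_on_circle (p : Polynomial ℂ)
    (h0 : p.coeff 0 ≠ 0)
    (h1 : ∀ z : ℂ, ‖z‖ = 1 → ‖Polynomial.eval z p‖ = 1) :
    ∃ c : ℂ, p = Polynomial.C c := by
  have hinf : (Metric.sphere (0 : ℂ) 1).Infinite := by
    apply IsPreconnected.infinite_of_nontrivial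
    · exact isPreconnected_sphere (by rw [Complex.rank_real_complex]; norm_num) 0 1
    · refine ⟨1, by simp, -1, by simp, ?_⟩
      norm_num [Complex.ext_iff]
  have key : p * (p.reverse.map (starRingEnd ℂ)) = Polynomial.X ^ p.natDegree := by
    apply Polynomial.eq_of_infinite_eval_eq
    refine hinf.mono ?_
    intro z hz
    have hz1 : ‖z‖ = 1 := by simpa using hz
    have hz0 : z ≠ 0 := by
      rintro rfl
      simp at hz1
    have hconj : (starRingEnd ℂ) z = z⁻¹ := (Complex.inv_eq_conj hz1).symm
    letI : Invertible z⁻¹ := invertibleOfNonzero (inv_ne_zero hz0)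
    have h := Polynomial.eval₂_reverse_mul_pow (starRingEnd ℂ) z⁻¹ p
    rw [invOf_eq_inv, inv_inv, ← hconj, Polynomial.eval₂_hom, hconj] at h
    have hn : Polynomial.eval z p * (starRingEnd ℂ) (Polynomial.eval z p) = 1 := by
      rw [Complex.mul_conj, Complex.normSq_eq_norm_sq, h1 z hz1]
      simp
    rw [← h, inv_pow] at hn
    have hzn : z ^ p.natDegree ≠ 0 := pow_ne_zero _ hz0
    simp only [Set.mem_setOf_eq, Polynomial.eval_mul, Polynomial.eval_map, Polynomial.eval_pow,
      Polynomial.eval_X]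
    field_simp at hn
    exact hn
  have hp : p ≠ 0 := by
    rintro rfl
    simp at h0
  have hd : p.natDegree = 0 := by
    by_contra hne
    have h := congrArg (fun q => Polynomial.coeff q 0) key
    simp only [Polynomial.mul_coeff_zero, Polynomial.coeff_map, Polynomial.coeff_zero_reverse,
      Polynomial.coeff_X_pow, if_neg (Ne.symm hne)] at h
    rcases mul_eq_zero.mp h with h | h
    · exact h0 h
    · exact hp (by simpa using h)
  exact ⟨p.coeff 0, Polynomial.eq_C_of_natDegree_eq_zero hd⟩
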